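/- arXiv:1611.04656 — 2 statements merged into one kernel-verified Lean document; each statement's English description precedes it below -/
import Mathlib

section
/- Let k ≥ 1 be an integer, let p and γ be real numbers with 1 ≤ p < ∞ and γ < k. Then for every nonnegative compactly supported C¹ function ψ : ℝᵏ → ℝ one has ((k−γ)/p)^p · ∫_{ℝᵏ} ψ(x)^p ‖x‖^{−γ} dx ≤ ∫_{ℝᵏ} ‖∇ψ(x)‖^p ‖x‖^{p−γ} dx. -/
open MeasureTheory Metric Real
open Filter Topology Module

/-- Minkowski's inequality for a weighted `L^p` norm, written with Bochner integrals. -/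
lemma weighted_Lp_add_le {α : Type*} [MeasurableSpace α] {μ : Measure α} {p : ℝ} (hp : 1 ≤ p)
    {f g w : α → ℝ} (hf : AEStronglyMeasurable f μ) (hg : AEStronglyMeasurable g μ)
    (hw : Measurable w) (hw0 : ∀ x, 0 ≤ w x)
    (hfi : Integrable (fun x => |f x| ^ p * w x) μ)
    (hgi : Integrable (fun x => |g x| ^ p * w x) μ) :
    (∫ x, |f x + g x| ^ p * w x ∂μ) ^ p⁻¹
      ≤ (∫ x, |f x| ^ p * w x ∂μ) ^ p⁻¹ + (∫ x, |g x| ^ p * w x ∂μ) ^ p⁻¹ := by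
  have hp0 : 0 < p := by linarith
  have hpE0 : ENNReal.ofReal p ≠ 0 := by simpa using hp0
  have hpt : (ENNReal.ofReal p).toReal = p := ENNReal.toReal_ofReal hp0.le
  have hroot : AEStronglyMeasurable (fun x => w x ^ p⁻¹) μ :=
    (hw.pow_const _).aestronglyMeasurable
  have hpow (h : α → ℝ) (x : α) :
      ‖h x * w x ^ p⁻¹‖ ^ p = |h x| ^ p * w x := by
    rw [norm_mul, Real.norm_eq_abs, Real.norm_of_nonneg (rpow_nonneg (hw0 x) _),
      mul_rpow (abs_nonneg _) (rpow_nonneg (hw0 x) _), rpow_inv_rpow (hw0 x) hp0.ne']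
  have hmem {h : α → ℝ} (hh : AEStronglyMeasurable h μ)
      (hhi : Integrable (fun x => |h x| ^ p * w x) μ) :
      MemLp (fun x => h x * w x ^ p⁻¹) (ENNReal.ofReal p) μ := by
    refine (integrable_norm_rpow_iff (hh.mul hroot) hpE0 ENNReal.ofReal_ne_top).1 ?_
    simpa only [Pi.mul_apply, hpt, hpow h] using hhi
  have hnorm {h : α → ℝ} (hm : MemLp (fun x => h x * w x ^ p⁻¹) (ENNReal.ofReal p) μ) :
      eLpNorm (fun x => h x * w x ^ p⁻¹) (ENNReal.ofReal p) μ
        = ENNReal.ofReal ((∫ x, |h x| ^ p * w x ∂μ) ^ p⁻¹) := by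
    rw [hm.eLpNorm_eq_integral_rpow_norm hpE0 ENNReal.ofReal_ne_top]
    simp only [hpt, hpow h]
  have hnn (h : α → ℝ) : 0 ≤ (∫ x, |h x| ^ p * w x ∂μ) ^ p⁻¹ :=
    rpow_nonneg (integral_nonneg fun x => mul_nonneg (rpow_nonneg (abs_nonneg _) _) (hw0 x)) _
  have hmf := hmem hf hfi
  have hmg := hmem hg hgi
  have hadd : (fun x => f x * w x ^ p⁻¹) + (fun x => g x * w x ^ p⁻¹)
      = fun x => (f x + g x) * w x ^ p⁻¹ := by
    ext x; simp [add_mul]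
  have key := eLpNorm_add_le hmf.1 hmg.1 (by simpa using hp : 1 ≤ ENNReal.ofReal p)
  rw [hadd, hnorm (h := fun x => f x + g x) (hadd ▸ hmf.add hmg), hnorm hmf, hnorm hmg,
    ← ENNReal.ofReal_add (hnn f) (hnn g)] at key
  exact (ENNReal.ofReal_le_ofReal_iff (add_nonneg (hnn f) (hnn g))).1 key

section Hardy

variable {E : Type*} [NormedAddCommGroup E] [NormedSpace ℝ E] [FiniteDimensional ℝ E]
  [MeasurableSpace E] [BorelSpace E] (μ : Measure E) [μ.IsAddHaarMeasure]

lemma locallyIntegrable_norm_rpow_neg {γ : ℝ} (hd : 1 ≤ finrank ℝ E) (hγ : γ < finrank ℝ E) :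
    LocallyIntegrable (fun x : E => ‖x‖ ^ (-γ)) μ :=
  locallyIntegrable_of_norm_le_rpow (C := 1) hd hγ
    (ae_of_all _ fun x => by simp [abs_of_nonneg (rpow_nonneg (norm_nonneg x) _)])
    (measurable_norm.pow_const _).aestronglyMeasurable

lemma integrable_mul_norm_rpow_neg {γ : ℝ} (hd : 1 ≤ finrank ℝ E) (hγ : γ < finrank ℝ E)
    {f : E → ℝ} (hf : Continuous f) (hfs : HasCompactSupport f) :
    Integrable (fun x => f x * ‖x‖ ^ (-γ)) μ :=
  (locallyIntegrable_norm_rpow_neg μ hd hγ).integrable_smul_left_of_hasCompactSupport hf hfs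

/-- The weighted `L^p` seminorm of a dilated function scales by a power of the dilation factor. -/
lemma integral_abs_rpow_comp_smul_mul_norm_rpow_neg (p γ : ℝ) (ψ : E → ℝ) {t : ℝ} (ht : 0 < t) :
    ∫ x, |ψ (t • x)| ^ p * ‖x‖ ^ (-γ) ∂μ
      = t ^ (-((finrank ℝ E : ℝ) - γ)) * ∫ x, |ψ x| ^ p * ‖x‖ ^ (-γ) ∂μ := by
  have h := Measure.integral_comp_smul_of_nonneg μ (fun x => |ψ x| ^ p * ‖x‖ ^ (-γ)) t (hR := ht.le)
  have h2 (x : E) : |ψ (t • x)| ^ p * ‖x‖ ^ (-γ)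
      = t ^ γ * (|ψ (t • x)| ^ p * ‖t • x‖ ^ (-γ)) := by
    rw [norm_smul, Real.norm_of_nonneg ht.le, mul_rpow ht.le (norm_nonneg x), rpow_neg ht.le]
    field_simp
  simp_rw [h2]
  rw [integral_const_mul, h, smul_eq_mul, ← mul_assoc, ← rpow_natCast, ← rpow_neg ht.le,
    ← rpow_add ht]
  ring_nf

/-- Radial difference quotients of a `C¹` compactly supported function converge in the weighted
`L^p` sense to the radial derivative. -/
lemma tendsto_integral_abs_dilation_quotient_rpow {p γ : ℝ} (hp : 1 ≤ p) (hd : 1 ≤ finrank ℝ E)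
    (hγ : γ < finrank ℝ E) {ψ : E → ℝ} (hψ : ContDiff ℝ 1 ψ) (hs : HasCompactSupport ψ) :
    Tendsto (fun t : ℝ => ∫ x, |(t - 1)⁻¹ * (ψ x - ψ (t • x))| ^ p * ‖x‖ ^ (-γ) ∂μ) (𝓝[>] 1)
      (𝓝 (∫ x, |fderiv ℝ ψ x x| ^ p * ‖x‖ ^ (-γ) ∂μ)) := by
  have hp0 : 0 < p := by linarith
  obtain ⟨C, hC⟩ := hψ.lipschitzWith_of_hasCompactSupport hs one_ne_zero
  obtain ⟨R, hR0, hR⟩ := hs.isCompact.isBounded.exists_pos_norm_le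
  have hzero {x : E} (hx : R < ‖x‖) : ψ x = 0 :=
    image_eq_zero_of_notMem_tsupport fun h => absurd (hR x h) (not_le.2 hx)
  refine tendsto_integral_filter_of_dominated_convergence
    ((closedBall 0 R).indicator fun x => (C * R) ^ p * ‖x‖ ^ (-γ)) ?_ ?_ ?_ ?_
  · refine .of_forall fun t => Measurable.aestronglyMeasurable ?_
    have := hψ.continuous.measurable
    fun_prop
  · filter_upwards [self_mem_nhdsWithin] with t (ht : 1 < t)
    refine ae_of_all _ fun x => ?_
    have hw : 0 ≤ ‖x‖ ^ (-γ) := rpow_nonneg (norm_nonneg x) _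
    rw [Real.norm_of_nonneg (by positivity)]
    by_cases hx : ‖x‖ ≤ R
    · rw [Set.indicator_of_mem (by simpa using hx)]
      gcongr
      have ht' : 0 < t - 1 := by linarith
      have hdist : |ψ x - ψ (t • x)| ≤ C * ((t - 1) * ‖x‖) := by
        have h := hC.dist_le_mul x (t • x)
        rwa [Real.dist_eq, dist_comm x, dist_eq_norm, show t • x - x = (t - 1) • x by
          rw [sub_smul, one_smul], norm_smul, Real.norm_of_nonneg ht'.le] at h
      rw [abs_mul, abs_of_pos (inv_pos.2 ht'), inv_mul_le_iff₀ ht']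
      calc |ψ x - ψ (t • x)| ≤ C * ((t - 1) * ‖x‖) := hdist
        _ = (t - 1) * (C * ‖x‖) := by ring
        _ ≤ (t - 1) * (C * R) := by gcongr
    · rw [Set.indicator_of_notMem (by simpa using hx)]
      push Not at hx
      have htx : R < ‖t • x‖ := by
        rw [norm_smul, Real.norm_of_nonneg (by linarith)]
        nlinarith [norm_nonneg x]
      simp [hzero hx, hzero htx, hp0.ne']
  · rw [integrable_indicator_iff measurableSet_closedBall]
    exact ((locallyIntegrable_norm_rpow_neg μ hd hγ).integrableOn_isCompact
      (isCompact_closedBall 0 R)).const_mul _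
  · refine ae_of_all _ fun x => ?_
    have hline : HasDerivAt (fun t : ℝ => ψ (t • x)) (fderiv ℝ ψ x x) 1 := by
      have h1 : HasFDerivAt ψ (fderiv ℝ ψ x) ((1 : ℝ) • x) := by
        simpa using (hψ.differentiable one_ne_zero x).hasFDerivAt
      have h2 : HasDerivAt (fun t : ℝ => t • x) x 1 := by
        simpa using (hasDerivAt_id (1 : ℝ)).smul_const x
      exact h1.comp_hasDerivAt 1 h2
    have hslope := (hasDerivAt_iff_tendsto_slope.1 hline).mono_left
      (nhdsWithin_mono 1 fun t (ht : 1 < t) => ht.ne')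
    refine Tendsto.mul_const _ (Tendsto.rpow_const ?_ (Or.inr hp0.le))
    refine hslope.abs.congr fun t => ?_
    rw [slope_def_module, one_smul, smul_eq_mul, ← neg_sub (ψ x), mul_neg, abs_neg]

/-- Hardy's inequality in terms of the radial derivative. -/
theorem hardy_radial {p γ : ℝ} (hp : 1 ≤ p) (hd : 1 ≤ finrank ℝ E)
    (hγ : γ < finrank ℝ E) {ψ : E → ℝ} (hψ : ContDiff ℝ 1 ψ) (hs : HasCompactSupport ψ) :
    (((finrank ℝ E : ℝ) - γ) / p) ^ p * ∫ x, |ψ x| ^ p * ‖x‖ ^ (-γ) ∂μ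
      ≤ ∫ x, |fderiv ℝ ψ x x| ^ p * ‖x‖ ^ (-γ) ∂μ := by
  have hp0 : 0 < p := by linarith
  set a : ℝ := ((finrank ℝ E : ℝ) - γ) / p with ha_def
  have ha : 0 < a := div_pos (by linarith) hp0
  set A : ℝ := ∫ x, |ψ x| ^ p * ‖x‖ ^ (-γ) ∂μ
  have hA0 : 0 ≤ A := integral_nonneg fun x => by positivity
  set D : ℝ → ℝ := fun t => ∫ x, |(t - 1)⁻¹ * (ψ x - ψ (t • x))| ^ p * ‖x‖ ^ (-γ) ∂μ
  set B : ℝ := ∫ x, |fderiv ℝ ψ x x| ^ p * ‖x‖ ^ (-γ) ∂μ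
  have hB0 : 0 ≤ B := integral_nonneg fun x => by positivity
  have hint {f : E → ℝ} (hf : Continuous f) (hfs : HasCompactSupport f) :
      Integrable (fun x => |f x| ^ p * ‖x‖ ^ (-γ)) μ :=
    integrable_mul_norm_rpow_neg μ hd hγ (hf.abs.rpow_const fun _ => Or.inr hp0.le)
      (hfs.comp_left (g := fun y => |y| ^ p) (by simp [hp0.ne']))
  have hquot : ∀ t : ℝ, 1 < t → (t - 1)⁻¹ * (1 - t ^ (-a)) * A ^ p⁻¹ ≤ D t ^ p⁻¹ := by
    intro t ht
    have ht0 : 0 < t := by linarith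
    have ht' : 0 < t - 1 := by linarith
    have hct : Continuous fun x => ψ (t • x) := hψ.continuous.comp (continuous_const_smul t)
    have hst : HasCompactSupport fun x => ψ (t • x) := hs.comp_smul ht0.ne'
    have hmink := weighted_Lp_add_le (μ := μ) (w := fun x : E => ‖x‖ ^ (-γ)) hp
      hct.aestronglyMeasurable (hψ.continuous.sub hct).aestronglyMeasurable
      (measurable_norm.pow_const _) (fun x => rpow_nonneg (norm_nonneg x) _)
      (hint hct hst) (hint (hψ.continuous.sub hct) (hs.sub hst))
    simp only [Pi.sub_apply, add_sub_cancel] at hmink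
    have hscale : (∫ x, |ψ (t • x)| ^ p * ‖x‖ ^ (-γ) ∂μ) ^ p⁻¹ = t ^ (-a) * A ^ p⁻¹ := by
      rw [integral_abs_rpow_comp_smul_mul_norm_rpow_neg μ p γ ψ ht0,
        mul_rpow (by positivity) hA0, ← rpow_mul ht0.le]
      congr 2
      rw [ha_def]; ring
    have hD : (∫ x, |ψ x - ψ (t • x)| ^ p * ‖x‖ ^ (-γ) ∂μ) ^ p⁻¹ = (t - 1) * D t ^ p⁻¹ := by
      have : ∀ x, |ψ x - ψ (t • x)| ^ p * ‖x‖ ^ (-γ)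
          = (t - 1) ^ p * (|(t - 1)⁻¹ * (ψ x - ψ (t • x))| ^ p * ‖x‖ ^ (-γ)) := fun x => by
        rw [← mul_assoc, ← mul_rpow ht'.le (abs_nonneg _), abs_mul, abs_of_pos (inv_pos.2 ht'),
          mul_inv_cancel_left₀ ht'.ne']
      simp_rw [this]
      rw [integral_const_mul, mul_rpow (by positivity) (integral_nonneg fun x => by positivity),
        rpow_rpow_inv ht'.le hp0.ne']
    rw [hscale, hD] at hmink
    rw [mul_assoc, inv_mul_le_iff₀ ht']
    linarith
  have hlimL : Tendsto (fun t : ℝ => (t - 1)⁻¹ * (1 - t ^ (-a)) * A ^ p⁻¹) (𝓝[>] 1)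
      (𝓝 (a * A ^ p⁻¹)) := by
    have hder : HasDerivAt (fun t : ℝ => -t ^ (-a)) a 1 := by
      simpa using (hasDerivAt_rpow_const (x := 1) (p := -a) (Or.inl one_ne_zero)).fun_neg
    refine Tendsto.mul_const _ (((hasDerivAt_iff_tendsto_slope.1 hder).mono_left
      (nhdsWithin_mono 1 fun t (ht : 1 < t) => ht.ne')).congr fun t => ?_)
    rw [slope_def_module, one_rpow, smul_eq_mul]
    ring
  have hlimR : Tendsto (fun t => D t ^ p⁻¹) (𝓝[>] 1) (𝓝 (B ^ p⁻¹)) :=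
    (tendsto_integral_abs_dilation_quotient_rpow μ hp hd hγ hψ hs).rpow_const
      (Or.inr (inv_nonneg.2 hp0.le))
  have hle : a * A ^ p⁻¹ ≤ B ^ p⁻¹ :=
    le_of_tendsto_of_tendsto hlimL hlimR
      (eventually_nhdsWithin_of_forall fun t ht => hquot t ht)
  have := rpow_le_rpow (by positivity) hle hp0.le
  rwa [mul_rpow ha.le (by positivity), rpow_inv_rpow hA0 hp0.ne', rpow_inv_rpow hB0 hp0.ne']
    at this

end Hardy

/-- Flat case of the Hardy inequality for submanifolds (Theorem `teo-hardy` of the paper,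
with `M = ℝᵏ`, so `Φ = 0` and there is no boundary term):
`((k−γ)/p)^p ∫ ψ^p ‖x‖^{−γ} ≤ ∫ ‖∇ψ‖^p ‖x‖^{p−γ}`. -/
theorem hardy_flat (k : ℕ) (hk : 1 ≤ k) (p γ : ℝ) (hp : 1 ≤ p) (hγ : γ < (k : ℝ))
    (ψ : EuclideanSpace ℝ (Fin k) → ℝ) (hψ : ContDiff ℝ 1 ψ)
    (hsupp : HasCompactSupport ψ) (hpos : ∀ x, 0 ≤ ψ x) :
    (((k : ℝ) - γ) / p) ^ p * ∫ x : EuclideanSpace ℝ (Fin k), ψ x ^ p * ‖x‖ ^ (-γ)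
      ≤ ∫ x : EuclideanSpace ℝ (Fin k), ‖gradient ψ x‖ ^ p * ‖x‖ ^ (p - γ) := by
  have hp0 : 0 < p := by linarith
  have hdim : finrank ℝ (EuclideanSpace ℝ (Fin k)) = k := by simp
  have hd : 1 ≤ finrank ℝ (EuclideanSpace ℝ (Fin k)) := hdim.symm ▸ hk
  have hγ' : γ < finrank ℝ (EuclideanSpace ℝ (Fin k)) := by rwa [hdim]
  have hradial := hardy_radial volume hp hd hγ' hψ hsupp
  simp only [hdim, abs_of_nonneg (hpos _)] at hradial
  refine hradial.trans ?_
  have : Nontrivial (EuclideanSpace ℝ (Fin k)) := nontrivial_of_finrank_pos (R := ℝ) (by omega)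
  have hcf : Continuous (fderiv ℝ ψ) := hψ.continuous_fderiv one_ne_zero
  have hsf : HasCompactSupport (fderiv ℝ ψ) := hsupp.fderiv ℝ
  have hweight : (fun x => ‖gradient ψ x‖ ^ p * ‖x‖ ^ (p - γ))
      =ᵐ[volume] fun x => (‖fderiv ℝ ψ x‖ * ‖x‖) ^ p * ‖x‖ ^ (-γ) := by
    filter_upwards [Measure.ae_ne volume 0] with x hx
    rw [gradient, LinearIsometryEquiv.norm_map, mul_rpow (norm_nonneg _) (norm_nonneg _),
      sub_eq_add_neg, rpow_add (norm_pos_iff.2 hx), mul_assoc]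
  have hcont : Continuous fun x => (‖fderiv ℝ ψ x‖ * ‖x‖) ^ p :=
    (hcf.norm.mul continuous_norm).rpow_const fun _ => Or.inr hp0.le
  have hcs : HasCompactSupport fun x => (‖fderiv ℝ ψ x‖ * ‖x‖) ^ p :=
    hsf.mono fun x hx hx' => hx (by simp [hx', hp0.ne'])
  rw [integral_congr_ae hweight]
  refine integral_mono_of_nonneg (ae_of_all _ fun x => by positivity)
    (integrable_mul_norm_rpow_neg volume hd hγ' hcont hcs) (ae_of_all _ fun x => ?_)
  have hle : |fderiv ℝ ψ x x| ≤ ‖fderiv ℝ ψ x‖ * ‖x‖ := (fderiv ℝ ψ x).le_opNorm x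
  dsimp only
  gcongr
end

section
/- Let k ≥ 1 be an integer, let p and γ be real numbers with p > 1 and 2 − (p−1)(k−2) < γ < k, set A = (k−γ)^p · (γ−2+(p−1)(k−2))^p / p^{2p}, and let ψ : ℝᵏ → ℝ be a nonnegative compactly supported C² function. If A · ∫_{ℝᵏ} ψ(x)^p ‖x‖^{−γ} dx = ∫_{ℝᵏ} |Δψ(x)|^p ‖x‖^{2p−γ} dx, then ψ ≡ 0 on ℝᵏ. -/
open MeasureTheory Metric Real

/-- The Laplacian `Δψ(x) = Σᵢ ∂²ψ/∂xᵢ²(x)` of a function on Euclidean space, as the sum of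
the second derivatives along the standard coordinate directions. -/
noncomputable def euclideanLaplacian {k : ℕ} (ψ : EuclideanSpace ℝ (Fin k) → ℝ)
    (x : EuclideanSpace ℝ (Fin k)) : ℝ :=
  ∑ i : Fin k, iteratedDeriv 2 (fun t : ℝ => ψ (x + t • EuclideanSpace.single i 1)) 0

open Filter Topology

/-- A nonnegative function on the line whose second derivative is at most `M` satisfies
`f' ^ 2 ≤ 2 M f`. -/
lemma sq_deriv_le_of_nonneg {f f' f'' : ℝ → ℝ} {M : ℝ} (hf : ∀ t, HasDerivAt f (f' t) t)
    (hf' : ∀ t, HasDerivAt f' (f'' t) t) (hpos : ∀ t, 0 ≤ f t) (hM : ∀ t, f'' t ≤ M) (t : ℝ) :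
    f' t ^ 2 ≤ 2 * M * f t := by
  have hanti : Antitone fun s => f' s - M * s := by
    refine antitone_of_hasDerivAt_nonpos (f' := fun s => f'' s - M) (fun s => ?_)
      fun s => by simpa using hM s
    exact ((hf' s).sub ((hasDerivAt_id s).const_mul M)).congr_deriv (by simp)
  have htaylor (s : ℝ) : f s ≤ f t + f' t * (s - t) + M / 2 * (s - t) ^ 2 := by
    let h : ℝ → ℝ := fun s => f s - f' t * (s - t) - M / 2 * (s - t) ^ 2
    have hh (s : ℝ) : HasDerivAt h (f' s - M * s - (f' t - M * t)) s := by
      have h1 : HasDerivAt (fun s => s - t) 1 s := (hasDerivAt_id s).sub_const t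
      have := ((hf s).sub (h1.const_mul (f' t))).sub ((h1.pow 2).const_mul (M / 2))
      refine this.congr_deriv ?_
      push_cast
      ring
    have hcont : Continuous h := continuous_iff_continuousAt.2 fun s => (hh s).continuousAt
    have key : h s ≤ h t := by
      rcases le_total t s with hts | hst
      · refine antitoneOn_of_deriv_nonpos (convex_Ici t) hcont.continuousOn
          (fun y _ => (hh y).differentiableAt.differentiableWithinAt) (fun y hy => ?_)
          Set.self_mem_Ici hts hts
        rw [interior_Ici] at hy
        rw [(hh y).deriv]
        exact sub_nonpos.2 (hanti (le_of_lt hy))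
      · refine monotoneOn_of_deriv_nonneg (convex_Iic t) hcont.continuousOn
          (fun y _ => (hh y).differentiableAt.differentiableWithinAt) (fun y hy => ?_)
          hst Set.self_mem_Iic hst
        rw [interior_Iic] at hy
        rw [(hh y).deriv]
        exact sub_nonneg.2 (hanti (le_of_lt hy))
    simp only [h] at key
    linarith
  have hdisc := discrim_le_zero (a := M / 2) (b := f' t) (c := f t) fun s => by
    have := (hpos (t + s)).trans (htaylor (t + s))
    rw [add_sub_cancel_left] at this
    linarith
  rw [discrim] at hdisc
  linarith

/-- For `p > 1` and `f ≥ 0`, the function `f ^ (p - 1) * f'` is differentiable wherever `f'` is,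
including at the zeros of `f`. -/
lemma hasDerivAt_rpow_mul_deriv {f f' : ℝ → ℝ} {p d t₀ : ℝ} (hp : 1 < p)
    (hf : HasDerivAt f (f' t₀) t₀) (hf' : HasDerivAt f' d t₀) (hpos : ∀ t, 0 ≤ f t) :
    HasDerivAt (fun t => f t ^ (p - 1) * f' t)
      (f t₀ ^ (p - 1) * d + (p - 1) * (f t₀ ^ (p - 2) * f' t₀ ^ 2)) t₀ := by
  rcases (hpos t₀).eq_or_lt with h0 | h0
  · have hmin : f' t₀ = 0 :=
      IsLocalMin.hasDerivAt_eq_zero (Eventually.of_forall fun t => h0 ▸ hpos t) hf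
    rw [hmin, ← h0, zero_rpow (by linarith)]
    have hlim : Tendsto (fun t => f t ^ (p - 1)) (𝓝 t₀) (𝓝 0) := by
      have := hf.continuousAt.tendsto.rpow_const (p := p - 1) (Or.inr (by linarith))
      rwa [← h0, zero_rpow (by linarith)] at this
    have hO : (fun t => f' t) =O[𝓝 t₀] fun t => t - t₀ := by
      simpa [hmin] using hf'.isBigO_sub
    have ho : (fun t => f t ^ (p - 1) * f' t) =o[𝓝 t₀] fun t => t - t₀ := by
      simpa using ((Asymptotics.isLittleO_one_iff ℝ).2 hlim).mul_isBigO hO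
    rw [hasDerivAt_iff_isLittleO]
    simpa [hmin] using ho
  · refine ((hf.rpow_const (p := p - 1) (Or.inl h0.ne')).mul hf').congr_deriv ?_
    rw [show p - 1 - 1 = p - 2 by ring]
    ring

lemma mul_rpow_sub_one_le {a b p : ℝ} (hp : 1 < p) (ha : 0 ≤ a) (hb : 0 ≤ b) :
    p * (a * b ^ (p - 1)) ≤ a ^ p + (p - 1) * b ^ p := by
  have hy := young_inequality_of_nonneg ha (rpow_nonneg hb (p - 1))
    (HolderConjugate.conjExponent hp)
  rw [← rpow_mul hb, conjExponent, mul_div_cancel₀ _ (by linarith : p - 1 ≠ 0)] at hy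
  have hp0 : 0 < p := by linarith
  have := mul_le_mul_of_nonneg_left hy hp0.le
  refine this.trans_eq ?_
  have : p - 1 ≠ 0 := by linarith
  field_simp

section RegularizedDivergence

variable {E : Type*} [NormedAddCommGroup E]

/-- The divergence of the regularized Rellich vector field along one coordinate direction, with
`‖x‖ ^ 2` replaced by `‖x‖ ^ 2 + ε`. -/
noncomputable def regularizedDivergence (γ : ℝ) (P Q S q : E → ℝ) (ε : ℝ) (x : E) : ℝ :=
  (‖x‖ ^ 2 + ε) ^ (-γ / 2) *
    (P x * (‖x‖ ^ 2 + ε) + Q x + S x * (1 - γ * q x / (‖x‖ ^ 2 + ε)))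

lemma rpow_norm_sq_add_le {γ R ε : ℝ} {x : E} (hε : 0 ≤ ε) (hε1 : ε ≤ 1) (hx : x ≠ 0)
    (hxR : ‖x‖ ≤ R) :
    (‖x‖ ^ 2 + ε) ^ (-γ / 2) ≤ ‖x‖ ^ (-γ) + (R ^ 2 + 1) ^ (-γ / 2) := by
  have hx0 : 0 < ‖x‖ := norm_pos_iff.2 hx
  rcases le_total 0 (-γ / 2) with h | h
  · refine (rpow_le_rpow (by positivity) (show ‖x‖ ^ 2 + ε ≤ R ^ 2 + 1 by gcongr) h).trans ?_
    exact le_add_of_nonneg_left (by positivity)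
  · refine (rpow_le_rpow_of_nonpos (by positivity) (le_add_of_nonneg_right hε) h).trans ?_
    rw [← rpow_natCast, ← rpow_mul hx0.le, show ((2 : ℕ) : ℝ) * (-γ / 2) = -γ by push_cast; ring]
    exact le_add_of_nonneg_right (by positivity)

variable {γ R K : ℝ} {P Q S q : E → ℝ}

lemma abs_regularizedDivergence_le (hP : ∀ x, |P x| ≤ K) (hQ : ∀ x, |Q x| ≤ K)
    (hS : ∀ x, |S x| ≤ K) (hPR : ∀ x, R ≤ ‖x‖ → P x = 0) (hQR : ∀ x, R ≤ ‖x‖ → Q x = 0)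
    (hSR : ∀ x, R ≤ ‖x‖ → S x = 0) (hq0 : ∀ x, 0 ≤ q x) (hq : ∀ x, q x ≤ ‖x‖ ^ 2) {ε : ℝ}
    (hε : 0 ≤ ε) (hε1 : ε ≤ 1) {x : E} (hx : x ≠ 0) :
    |regularizedDivergence γ P Q S q ε x| ≤
      (ball (0 : E) R).indicator (fun _ => K * (R ^ 2 + 1) + K + K * (1 + |γ|)) x * ‖x‖ ^ (-γ) +
      (ball (0 : E) R).indicator
        (fun _ => (K * (R ^ 2 + 1) + K + K * (1 + |γ|)) * (R ^ 2 + 1) ^ (-γ / 2)) x *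
        ‖x‖ ^ (0 : ℝ) := by
  rcases le_or_gt R ‖x‖ with h | h
  · have : x ∉ ball (0 : E) R := by simpa using h
    simp [regularizedDivergence, hPR x h, hQR x h, hSR x h, this]
  · have hmem : x ∈ ball (0 : E) R := by simpa using h
    have hx0 : 0 < ‖x‖ := norm_pos_iff.2 hx
    have hK : 0 ≤ K := (abs_nonneg _).trans (hP x)
    have hw : 0 < ‖x‖ ^ 2 + ε := by positivity
    have hquot : |1 - γ * q x / (‖x‖ ^ 2 + ε)| ≤ 1 + |γ| := by
      refine (abs_sub _ _).trans ?_
      rw [abs_one, mul_div_assoc, abs_mul]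
      gcongr
      rw [abs_of_nonneg (div_nonneg (hq0 x) hw.le)]
      exact mul_le_of_le_one_right (abs_nonneg _) ((div_le_one hw).2 ((hq x).trans (by linarith)))
    rw [Set.indicator_of_mem hmem, Set.indicator_of_mem hmem, rpow_zero, mul_one,
      regularizedDivergence, abs_mul, abs_of_nonneg (by positivity), ← mul_add, mul_comm]
    refine mul_le_mul ?_ (rpow_norm_sq_add_le hε hε1 hx h.le) (by positivity) (by positivity)
    refine (abs_add_le _ _).trans (add_le_add ((abs_add_le _ _).trans (add_le_add ?_ (hQ x))) ?_)
    · rw [abs_mul, abs_of_pos hw]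
      exact mul_le_mul (hP x) (by gcongr) hw.le hK
    · rw [abs_mul]
      exact mul_le_mul (hS x) hquot (abs_nonneg _) hK

end RegularizedDivergence

section Integrals

variable {E : Type*} [NormedAddCommGroup E] [NormedSpace ℝ E] [FiniteDimensional ℝ E]
  [MeasurableSpace E] [BorelSpace E] {μ : Measure E} [μ.IsAddHaarMeasure]

lemma integrableOn_norm_rpow_ball [Nontrivial E] {s R : ℝ} (hR : 0 < R)
    (hs : -(Module.finrank ℝ E : ℝ) < s) :
    IntegrableOn (fun x : E => ‖x‖ ^ s) (ball 0 R) μ := by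
  rw [integrableOn_fun_norm_addHaar μ (f := fun y => y ^ s)]
  have hpos : 1 ≤ Module.finrank ℝ E := Module.finrank_pos
  refine ((intervalIntegral.integrableOn_Ioo_rpow_iff (s := Module.finrank ℝ E - 1 + s) hR).2
    (by linarith)).congr_fun (fun y hy => ?_) measurableSet_Ioo
  beta_reduce
  rw [rpow_add hy.1, smul_eq_mul, ← rpow_natCast, Nat.cast_sub hpos, Nat.cast_one]

lemma integrable_mul_norm_rpow [Nontrivial E] {f : E → ℝ} {s R K : ℝ} (hR : 0 < R)
    (hs : -(Module.finrank ℝ E : ℝ) < s) (hf : AEStronglyMeasurable f μ) (hK : ∀ x, |f x| ≤ K)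
    (hfR : ∀ x, R ≤ ‖x‖ → f x = 0) : Integrable (fun x => f x * ‖x‖ ^ s) μ := by
  have h := (integrableOn_norm_rpow_ball (μ := μ) hR hs).bdd_mul hf.restrict
    (Eventually.of_forall hK)
  rwa [← IntegrableOn, integrableOn_iff_integrable_of_support_subset] at h
  intro x hx
  by_contra hxR
  exact hx (by simp [hfR x (by simpa using hxR)])

lemma integrable_abs_rpow_mul_norm_rpow [Nontrivial E] {f : E → ℝ} {p s : ℝ} (hf : Continuous f)
    (hsupp : HasCompactSupport f) (hp : 0 < p) (hs : -(Module.finrank ℝ E : ℝ) < s) :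
    Integrable (fun x => |f x| ^ p * ‖x‖ ^ s) μ := by
  have hc : Continuous fun x => |f x| ^ p := hf.abs.rpow_const fun _ => Or.inr hp.le
  have hcs : HasCompactSupport fun x => |f x| ^ p :=
    hsupp.comp_left (g := fun t : ℝ => |t| ^ p) (by simp [zero_rpow hp.ne'])
  obtain ⟨K, hK⟩ := hcs.exists_bound_of_continuous hc
  obtain ⟨R, hR, hzero⟩ := hcs.exists_pos_le_norm
  exact integrable_mul_norm_rpow hR hs hc.aestronglyMeasurable hK hzero

lemma integral_eq_zero_of_hasLineDerivAt {f f' : E → ℝ} {v : E} (hf : Integrable f μ)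
    (hf' : Integrable f' μ) (hd : ∀ x, HasLineDerivAt ℝ f (f' x) x v) : ∫ x, f' x ∂μ = 0 := by
  have h := integral_bilinear_hasLineDerivAt_right_eq_neg_left_of_integrable (μ := μ)
    (f := f) (f' := f') (g := fun _ => (1 : ℝ)) (g' := fun _ => 0) (v := v)
    (B := ContinuousLinearMap.mul ℝ ℝ) (by simpa using hf') (by simp) (by simpa using hf)
    (fun x _ => hd x) (fun x _ => by simpa [HasLineDerivAt] using hasDerivAt_const (0 : ℝ) (1 : ℝ))
  simpa using h.symm

variable {γ R K : ℝ} {P Q S q : E → ℝ}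

/-- The regularized divergences are integrable, uniformly enough to let `ε → 0`. -/
lemma tendsto_integral_regularizedDivergence [Nontrivial E] (hγ : γ < Module.finrank ℝ E)
    (hR : 0 < R) (hPm : Measurable P) (hQm : Measurable Q) (hSm : Measurable S)
    (hqm : Measurable q) (hP : ∀ x, |P x| ≤ K) (hQ : ∀ x, |Q x| ≤ K)
    (hS : ∀ x, |S x| ≤ K) (hPR : ∀ x, R ≤ ‖x‖ → P x = 0) (hQR : ∀ x, R ≤ ‖x‖ → Q x = 0)
    (hSR : ∀ x, R ≤ ‖x‖ → S x = 0) (hq0 : ∀ x, 0 ≤ q x) (hq : ∀ x, q x ≤ ‖x‖ ^ 2) :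
    (∀ ε, 0 ≤ ε → ε ≤ 1 → Integrable (regularizedDivergence γ P Q S q ε) μ) ∧
    Tendsto (fun ε => ∫ x, regularizedDivergence γ P Q S q ε x ∂μ) (𝓝[>] 0)
      (𝓝 (∫ x, regularizedDivergence γ P Q S q 0 x ∂μ)) := by
  have hne : ∀ᵐ x : E ∂μ, x ≠ 0 := by simp [ae_iff]
  have hmeas (ε : ℝ) : AEStronglyMeasurable (regularizedDivergence γ P Q S q ε) μ := by
    have : Measurable (regularizedDivergence γ P Q S q ε) := by
      unfold regularizedDivergence
      fun_prop
    exact this.aestronglyMeasurable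
  have hind (c s : ℝ) (hs : -(Module.finrank ℝ E : ℝ) < s) :
      Integrable (fun x : E => (ball (0 : E) R).indicator (fun _ => c) x * ‖x‖ ^ s) μ := by
    refine integrable_mul_norm_rpow (K := |c|) hR hs
      (measurable_const.indicator measurableSet_ball).aestronglyMeasurable (fun x => ?_)
      fun x hx => by simp [hx]
    by_cases hx : x ∈ ball (0 : E) R <;> simp [hx]
  have hdim : (0 : ℝ) < Module.finrank ℝ E := Nat.cast_pos.2 Module.finrank_pos
  have hbound := (hind (K * (R ^ 2 + 1) + K + K * (1 + |γ|)) (-γ) (by linarith)).add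
    (hind ((K * (R ^ 2 + 1) + K + K * (1 + |γ|)) * (R ^ 2 + 1) ^ (-γ / 2)) 0 (by linarith))
  have hle (ε : ℝ) (hε : 0 ≤ ε) (hε1 : ε ≤ 1) := hne.mono fun x hx =>
    abs_regularizedDivergence_le (γ := γ) hP hQ hS hPR hQR hSR hq0 hq hε hε1 hx
  refine ⟨fun ε hε hε1 => hbound.mono' (hmeas ε) (hle ε hε hε1),
    tendsto_integral_filter_of_dominated_convergence _ (Eventually.of_forall hmeas) ?_ hbound ?_⟩
  · filter_upwards [Ioc_mem_nhdsGT (zero_lt_one' ℝ)] with ε hε using hle ε hε.1.le hε.2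
  · filter_upwards [hne] with x hx
    have hx0 : ‖x‖ ^ 2 + 0 ≠ 0 := by simpa using hx
    have : ContinuousAt (fun ε => regularizedDivergence γ P Q S q ε x) 0 := by
      unfold regularizedDivergence
      have hw : ContinuousAt (fun ε : ℝ => ‖x‖ ^ 2 + ε) 0 := by fun_prop
      exact (hw.rpow_const (Or.inl hx0)).mul (((continuousAt_const.mul hw).add
        continuousAt_const).add (continuousAt_const.mul
          (continuousAt_const.sub (continuousAt_const.div hw hx0))))
    exact this.tendsto.mono_left nhdsWithin_le_nhds

end Integrals

section VectorField

variable {E : Type*} [NormedAddCommGroup E] [InnerProductSpace ℝ E] {ψ : E → ℝ} {v : E}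
  {p γ c : ℝ}

lemma hasDerivAt_comp_line {φ : E → ℝ} (hφ : Differentiable ℝ φ) (x v : E) (t : ℝ) :
    HasDerivAt (fun s : ℝ => φ (x + s • v)) (fderiv ℝ φ (x + t • v) v) t := by
  have h : HasDerivAt (fun s : ℝ => x + s • v) v t := by
    simpa using ((hasDerivAt_id t).smul_const v).const_add x
  exact (hφ (x + t • v)).hasFDerivAt.comp_hasDerivAt t h

lemma ContDiff.fderiv_apply_const_one (hψ : ContDiff ℝ 2 ψ) (v : E) :
    ContDiff ℝ 1 fun y => fderiv ℝ ψ y v :=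
  (hψ.fderiv_right (m := 1) (by norm_num)).clm_apply contDiff_const

lemma iteratedDeriv_two_comp_line (hψ : ContDiff ℝ 2 ψ) (x v : E) :
    iteratedDeriv 2 (fun t : ℝ => ψ (x + t • v)) 0 =
      fderiv ℝ (fun y => fderiv ℝ ψ y v) x v := by
  have h1 : deriv (fun t : ℝ => ψ (x + t • v)) = fun t : ℝ => fderiv ℝ ψ (x + t • v) v :=
    funext fun t => (hasDerivAt_comp_line (hψ.differentiable (by norm_num)) x v t).deriv
  rw [iteratedDeriv_succ, iteratedDeriv_one, h1]
  simpa using (hasDerivAt_comp_line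
    ((hψ.fderiv_apply_const_one v).differentiable (by norm_num)) x v 0).deriv

lemma fderiv_apply_eq_zero_of_nonneg (hpos : ∀ x, 0 ≤ ψ x) {x : E} (hx : ψ x = 0) :
    fderiv ℝ ψ x v = 0 := by
  have : IsLocalMin ψ x := Eventually.of_forall fun y => hx ▸ hpos y
  simp [this.fderiv_eq_zero]

lemma sq_fderiv_apply_le (hψ : ContDiff ℝ 2 ψ) (hpos : ∀ x, 0 ≤ ψ x) {M : ℝ}
    (hM : ∀ x, fderiv ℝ (fun y => fderiv ℝ ψ y v) x v ≤ M) (x : E) :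
    fderiv ℝ ψ x v ^ 2 ≤ 2 * M * ψ x := by
  simpa using sq_deriv_le_of_nonneg
    (hasDerivAt_comp_line (hψ.differentiable (by norm_num)) x v)
    (hasDerivAt_comp_line ((hψ.fderiv_apply_const_one v).differentiable (by norm_num)) x v)
    (fun _ => hpos _) (fun _ => hM _) 0

lemma rpow_mul_sq_fderiv_apply_le (hψ : ContDiff ℝ 2 ψ) (hpos : ∀ x, 0 ≤ ψ x) (hp : 1 < p) {M : ℝ}
    (hM : ∀ x, fderiv ℝ (fun y => fderiv ℝ ψ y v) x v ≤ M) (x : E) :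
    ψ x ^ (p - 2) * fderiv ℝ ψ x v ^ 2 ≤ 2 * M * ψ x ^ (p - 1) := by
  rcases (hpos x).eq_or_lt with h0 | h0
  · simp [fderiv_apply_eq_zero_of_nonneg hpos h0.symm, ← h0, zero_rpow (by linarith : p - 1 ≠ 0)]
  · refine (mul_le_mul_of_nonneg_left (sq_fderiv_apply_le hψ hpos hM x) (by positivity)).trans_eq ?_
    rw [show p - 1 = p - 2 + 1 by ring, rpow_add h0, rpow_one]
    ring

/-- Directional derivative of the regularized Rellich vector field
`ψ ^ (p - 1) ∇ψ (‖x‖ ^ 2 + ε) ^ (1 - γ / 2) + c ψ ^ p (‖x‖ ^ 2 + ε) ^ (-γ / 2) x`. -/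
lemma hasLineDerivAt_rellichField (hψ : ContDiff ℝ 2 ψ) (hpos : ∀ x, 0 ≤ ψ x) (hp : 1 < p)
    (hv : ‖v‖ = 1) {ε : ℝ} (hε : 0 < ε) (x : E) :
    HasLineDerivAt ℝ
      (fun x => ψ x ^ (p - 1) * fderiv ℝ ψ x v * (‖x‖ ^ 2 + ε) ^ (1 - γ / 2) +
        c * (ψ x ^ p * ((‖x‖ ^ 2 + ε) ^ (-γ / 2) * inner ℝ v x)))
      (regularizedDivergence γ
        (fun x => ψ x ^ (p - 1) * fderiv ℝ (fun y => fderiv ℝ ψ y v) x v +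
          (p - 1) * (ψ x ^ (p - 2) * fderiv ℝ ψ x v ^ 2))
        (fun x => (2 - γ + c * p) * (ψ x ^ (p - 1) * fderiv ℝ ψ x v * inner ℝ v x))
        (fun x => c * ψ x ^ p) (fun x => inner ℝ v x ^ 2) ε x) x v := by
  have hd := hasDerivAt_comp_line (hψ.differentiable (by norm_num)) x v
  have hd2 := hasDerivAt_comp_line
    ((hψ.fderiv_apply_const_one v).differentiable (by norm_num)) x v 0
  have hF := hasDerivAt_rpow_mul_deriv hp (hd 0) hd2 fun _ => hpos _
  have hG := (hd 0).rpow_const (p := p) (Or.inr hp.le)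
  have hI : HasDerivAt (fun t : ℝ => inner ℝ v (x + t • v)) 1 0 := by
    have : (fun t : ℝ => inner ℝ v (x + t • v)) = fun t => inner ℝ v x + t := by
      funext t
      simp [inner_add_right, inner_smul_right, hv]
    rw [this]
    exact (hasDerivAt_id (0 : ℝ)).const_add _
  have hW : HasDerivAt (fun t : ℝ => ‖x + t • v‖ ^ 2 + ε) (2 * inner ℝ v x) 0 := by
    have h : HasDerivAt (fun t : ℝ => x + t • v) v 0 := by
      simpa using ((hasDerivAt_id (0 : ℝ)).smul_const v).const_add x
    refine (h.norm_sq.add_const ε).congr_deriv ?_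
    simp [real_inner_comm]
  have hw : 0 < ‖x‖ ^ 2 + ε := by positivity
  have hw0 : ‖x + (0 : ℝ) • v‖ ^ 2 + ε ≠ 0 := by simpa using hw.ne'
  have hW1 := hW.rpow_const (p := 1 - γ / 2) (Or.inl hw0)
  have hW2 := hW.rpow_const (p := -γ / 2) (Or.inl hw0)
  refine ((hF.mul hW1).add ((hG.mul (hW2.mul hI)).const_mul c)).congr_deriv ?_
  simp only [Pi.mul_apply, zero_smul, add_zero, regularizedDivergence]
  have e1 : (‖x‖ ^ 2 + ε) ^ (1 - γ / 2) = (‖x‖ ^ 2 + ε) ^ (-γ / 2) * (‖x‖ ^ 2 + ε) := by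
    rw [show 1 - γ / 2 = -γ / 2 + 1 by ring, rpow_add hw, rpow_one]
  have e2 : (‖x‖ ^ 2 + ε) ^ (-γ / 2 - 1) = (‖x‖ ^ 2 + ε) ^ (-γ / 2) / (‖x‖ ^ 2 + ε) := by
    rw [rpow_sub hw, rpow_one]
  rw [e2, show 1 - γ / 2 - 1 = -γ / 2 by ring, e1]
  field_simp
  ring

lemma integral_rellichField_divergence [FiniteDimensional ℝ E] [Nontrivial E]
    [MeasurableSpace E] [BorelSpace E] {μ : Measure E} [μ.IsAddHaarMeasure]
    (hψ : ContDiff ℝ 2 ψ) (hsupp : HasCompactSupport ψ) (hpos : ∀ x, 0 ≤ ψ x) (hp : 1 < p)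
    (hγ : γ < Module.finrank ℝ E) (c : ℝ) (hv : ‖v‖ = 1) :
    let D := regularizedDivergence γ
        (fun x => ψ x ^ (p - 1) * fderiv ℝ (fun y => fderiv ℝ ψ y v) x v +
          (p - 1) * (ψ x ^ (p - 2) * fderiv ℝ ψ x v ^ 2))
        (fun x => (2 - γ + c * p) * (ψ x ^ (p - 1) * fderiv ℝ ψ x v * inner ℝ v x))
        (fun x => c * ψ x ^ p) (fun x => inner ℝ v x ^ 2) 0
    Integrable D μ ∧ ∫ x, D x ∂μ = 0 := by
  intro D
  have hp1 : 0 < p - 1 := by linarith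
  have hψc := hψ.continuous
  have hg := hψ.fderiv_apply_const_one v
  have hgc := hg.continuous
  have hHc : Continuous fun x => fderiv ℝ (fun y => fderiv ℝ ψ y v) x v :=
    (hg.continuous_fderiv (by norm_num)).clm_apply continuous_const
  have hgs : HasCompactSupport fun x => fderiv ℝ ψ x v := hsupp.fderiv_apply (𝕜 := ℝ) v
  have hHs : HasCompactSupport fun x => fderiv ℝ (fun y => fderiv ℝ ψ y v) x v :=
    hgs.fderiv_apply (𝕜 := ℝ) v
  have hpowc : Continuous fun x => ψ x ^ (p - 1) := hψc.rpow_const fun _ => Or.inr hp1.le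
  have hpowc' : Continuous fun x => ψ x ^ p := hψc.rpow_const fun _ => Or.inr (by linarith)
  have hpows : HasCompactSupport fun x => ψ x ^ (p - 1) :=
    hsupp.comp_left (g := fun t : ℝ => t ^ (p - 1)) (zero_rpow hp1.ne')
  have hpows' : HasCompactSupport fun x => ψ x ^ p :=
    hsupp.comp_left (g := fun t : ℝ => t ^ p) (zero_rpow (by linarith))
  obtain ⟨M, hM⟩ := hHs.exists_bound_of_continuous hHc
  obtain ⟨L, hL⟩ := hpows.exists_bound_of_continuous hpowc
  obtain ⟨K₁, hK₁⟩ := (hpows.mul_right (f' := fun x => fderiv ℝ (fun y => fderiv ℝ ψ y v) x v)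
    ).exists_bound_of_continuous (hpowc.mul hHc)
  obtain ⟨K₂, hK₂⟩ := ((hpows.mul_right (f' := fun x => fderiv ℝ ψ x v)).mul_right
    (f' := fun x => inner ℝ v x)).exists_bound_of_continuous ((hpowc.mul hgc).mul (by fun_prop))
  obtain ⟨K₃, hK₃⟩ := hpows'.exists_bound_of_continuous hpowc'
  obtain ⟨R, hR, hψR⟩ := hsupp.exists_pos_le_norm
  have hsq (x : E) : |ψ x ^ (p - 2) * fderiv ℝ ψ x v ^ 2| ≤ 2 * M * L := by
    have hMnonneg : 0 ≤ M := (norm_nonneg _).trans (hM x)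
    rw [abs_of_nonneg (mul_nonneg (rpow_nonneg (hpos x) _) (sq_nonneg _))]
    refine (rpow_mul_sq_fderiv_apply_le hψ hpos hp (fun y => (le_abs_self _).trans (hM y)) x).trans ?_
    gcongr
    exact (le_abs_self _).trans (hL x)
  have hPbd (x : E) : |ψ x ^ (p - 1) * fderiv ℝ (fun y => fderiv ℝ ψ y v) x v +
      (p - 1) * (ψ x ^ (p - 2) * fderiv ℝ ψ x v ^ 2)| ≤ K₁ + (p - 1) * (2 * M * L) := by
    refine (abs_add_le _ _).trans (add_le_add (hK₁ x) ?_)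
    rw [abs_mul, abs_of_pos hp1]
    gcongr
    exact hsq x
  have hQbd (x : E) : |(2 - γ + c * p) * (ψ x ^ (p - 1) * fderiv ℝ ψ x v * inner ℝ v x)| ≤
      |2 - γ + c * p| * K₂ := by
    rw [abs_mul]
    gcongr
    exact hK₂ x
  have hSbd (x : E) : |c * ψ x ^ p| ≤ |c| * K₃ := by
    rw [abs_mul]
    gcongr
    exact hK₃ x
  have hzero (x : E) (hx : R ≤ ‖x‖) : ψ x ^ (p - 1) = 0 ∧ fderiv ℝ ψ x v = 0 ∧ ψ x ^ p = 0 :=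
    ⟨by rw [hψR x hx, zero_rpow hp1.ne'], fderiv_apply_eq_zero_of_nonneg hpos (hψR x hx),
      by rw [hψR x hx, zero_rpow (by linarith)]⟩
  have hψm := hψc.measurable
  have hgm := hgc.measurable
  have hHm := hHc.measurable
  obtain ⟨hintegrable, hlim⟩ := tendsto_integral_regularizedDivergence (μ := μ) (γ := γ) (R := R)
    (K := max (K₁ + (p - 1) * (2 * M * L)) (max (|2 - γ + c * p| * K₂) (|c| * K₃)))
    (P := fun x => ψ x ^ (p - 1) * fderiv ℝ (fun y => fderiv ℝ ψ y v) x v +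
      (p - 1) * (ψ x ^ (p - 2) * fderiv ℝ ψ x v ^ 2))
    (Q := fun x => (2 - γ + c * p) * (ψ x ^ (p - 1) * fderiv ℝ ψ x v * inner ℝ v x))
    (S := fun x => c * ψ x ^ p) (q := fun x => inner ℝ v x ^ 2)
    hγ hR (by fun_prop) (by fun_prop) (by fun_prop) (by fun_prop)
    (fun x => (hPbd x).trans (le_max_left _ _))
    (fun x => (hQbd x).trans ((le_max_left _ _).trans (le_max_right _ _)))
    (fun x => (hSbd x).trans ((le_max_right _ _).trans (le_max_right _ _)))
    (fun x hx => by simp [hzero x hx]) (fun x hx => by simp [hzero x hx])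
    (fun x hx => by simp [hzero x hx]) (fun x => sq_nonneg _)
    (fun x => by
      have h := abs_real_inner_le_norm v x
      rw [hv, one_mul] at h
      exact sq_le_sq.2 (by rwa [abs_norm]))
  refine ⟨hintegrable 0 le_rfl zero_le_one, tendsto_nhds_unique hlim ?_⟩
  refine tendsto_const_nhds.congr' ?_
  filter_upwards [Ioc_mem_nhdsGT (zero_lt_one' ℝ)] with ε hε
  have hwne (x : E) : ‖x‖ ^ 2 + ε ≠ 0 := by
    have := hε.1
    positivity
  have hwc (s : ℝ) : Continuous fun x : E => (‖x‖ ^ 2 + ε) ^ s :=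
    (show Continuous fun x : E => ‖x‖ ^ 2 + ε by fun_prop).rpow_const fun x => Or.inl (hwne x)
  refine (integral_eq_zero_of_hasLineDerivAt ?_ (hintegrable ε hε.1.le hε.2)
    fun x => hasLineDerivAt_rellichField (c := c) (γ := γ) hψ hpos hp hv hε.1 x).symm
  have h1 := hwc (1 - γ / 2)
  have h2 := hwc (-γ / 2)
  refine Continuous.integrable_of_hasCompactSupport (by fun_prop) ?_
  exact hpows.mul_right.mul_right.add hpows'.mul_right.mul_left

end VectorField

lemma euclideanLaplacian_eq_sum_fderiv {k : ℕ} {ψ : EuclideanSpace ℝ (Fin k) → ℝ}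
    (hψ : ContDiff ℝ 2 ψ) (x : EuclideanSpace ℝ (Fin k)) :
    euclideanLaplacian ψ x = ∑ i, fderiv ℝ
      (fun y => fderiv ℝ ψ y (EuclideanSpace.single i 1)) x (EuclideanSpace.single i 1) :=
  Finset.sum_congr rfl fun _ _ => iteratedDeriv_two_comp_line hψ x _

lemma continuous_euclideanLaplacian {k : ℕ} {ψ : EuclideanSpace ℝ (Fin k) → ℝ}
    (hψ : ContDiff ℝ 2 ψ) : Continuous (euclideanLaplacian ψ) := by
  rw [funext (euclideanLaplacian_eq_sum_fderiv hψ)]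
  exact continuous_finsetSum _ fun i _ => ((hψ.fderiv_apply_const_one _).continuous_fderiv
    (by norm_num)).clm_apply continuous_const

lemma hasCompactSupport_euclideanLaplacian {k : ℕ} {ψ : EuclideanSpace ℝ (Fin k) → ℝ}
    (hψ : ContDiff ℝ 2 ψ) (hsupp : HasCompactSupport ψ) :
    HasCompactSupport (euclideanLaplacian ψ) := by
  rw [funext (euclideanLaplacian_eq_sum_fderiv hψ)]
  refine HasCompactSupport.intro hsupp fun x hx => Finset.sum_eq_zero fun i _ => ?_
  refine image_eq_zero_of_notMem_tsupport (f := fun x => fderiv ℝ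
      (fun y => fderiv ℝ ψ y (EuclideanSpace.single i 1)) x (EuclideanSpace.single i 1))
    fun hxt => hx ?_
  exact tsupport_fderiv_apply_subset ℝ _ (tsupport_fderiv_apply_subset ℝ _ hxt)

/-- The pointwise estimate behind the Rellich inequality, where `X` stands for `x · ∇ψ`, `G` for
`‖∇ψ‖ ^ 2`, `L` for `Δψ` and `s` for `‖x‖ ^ 2`. -/
lemma rellich_pointwise {p κ b B c y L G X s : ℝ} (hp : 1 < p) (hB : 0 < B)
    (hBdef : B = κ * b / p ^ 2) (hc : c * p ^ 2 = (p - 1) * κ + b) (hy : 0 ≤ y) (hs : 0 ≤ s)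
    (hX : X ^ 2 ≤ G * s) (hX0 : y = 0 → X = 0) (hG0 : y = 0 → G = 0) :
    p * B ^ (p - 1) * ((p - 1) * (y ^ (p - 2) * (X + κ / p * y) ^ 2)) ≤
      (|L| * s) ^ p - B ^ p * y ^ p + p * B ^ (p - 1) *
        ((y ^ (p - 1) * L + (p - 1) * (y ^ (p - 2) * G)) * s +
          2 * (p - 1) * κ / p * (y ^ (p - 1) * X) + c * κ * y ^ p) := by
  have hp0 : 0 < p := by linarith
  rcases hy.eq_or_lt with h0 | h0
  · rw [hX0 h0.symm, hG0 h0.symm, ← h0, zero_rpow (by linarith : p ≠ 0),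
      zero_rpow (by linarith : p - 1 ≠ 0)]
    simp only [mul_zero, zero_mul, add_zero, sub_zero, ne_eq, OfNat.ofNat_ne_zero,
      not_false_eq_true, zero_pow]
    positivity
  · have hyoung := mul_rpow_sub_one_le hp (by positivity : 0 ≤ |L| * s) (by positivity : 0 ≤ B * y)
    rw [mul_rpow hB.le hy, mul_rpow hB.le hy] at hyoung
    have e1 : y ^ (p - 1) = y ^ (p - 2) * y := by
      rw [show p - 1 = p - 2 + 1 by ring, rpow_add h0, rpow_one]
    have e2 : y ^ p = y ^ (p - 2) * y ^ 2 := by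
      rw [← rpow_natCast, ← rpow_add h0]
      norm_num
    have e3 : B ^ p = B ^ (p - 1) * B := by
      rw [← rpow_add_one hB.ne', sub_add_cancel]
    have hu : 0 < y ^ (p - 2) := rpow_pos_of_pos h0 _
    have hT : 0 < B ^ (p - 1) := rpow_pos_of_pos hB _
    rw [e1, e2, e3] at hyoung
    rw [e1, e2, e3]
    clear e1 e2 e3
    generalize y ^ (p - 2) = u at *
    generalize B ^ (p - 1) = T at *
    generalize (|L| * s) ^ p = N at *
    have hL : 0 ≤ p * T * (u * y) * s * (|L| + L) :=
      mul_nonneg (by positivity) (by linarith [neg_abs_le L])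
    have hCS : 0 ≤ p * T * ((p - 1) * u) * (G * s - X ^ 2) :=
      mul_nonneg (mul_nonneg (by positivity) (mul_nonneg (by linarith) hu.le)) (by linarith)
    have hcoef : c * κ - B = (p - 1) * (κ / p) ^ 2 := by
      rw [hBdef, eq_div_of_mul_eq (by positivity) hc]
      field_simp
      ring
    have hmain : p * T * (u * y ^ 2) * (c * κ - B) =
        p * T * (u * y ^ 2) * ((p - 1) * (κ / p) ^ 2) := by rw [hcoef]
    have hlin : 2 * (p - 1) * κ / p = 2 * (p - 1) * (κ / p) := by ring
    rw [hlin]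
    linarith

/-- Equality case of the flat Rellich inequality (Theorem `rellich` of the paper with
`M = ℝᵏ` and `p > 1`): if equality holds, then `ψ ≡ 0`. -/
theorem rellich_flat_equality (k : ℕ) (hk : 1 ≤ k) (p γ : ℝ) (hp : 1 < p)
    (hγ₁ : 2 - (p - 1) * ((k : ℝ) - 2) < γ) (hγ₂ : γ < (k : ℝ))
    (A : ℝ) (hA : A = ((k : ℝ) - γ) ^ p * (γ - 2 + (p - 1) * ((k : ℝ) - 2)) ^ p / p ^ (2 * p))
    (ψ : EuclideanSpace ℝ (Fin k) → ℝ) (hψ : ContDiff ℝ 2 ψ)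
    (hsupp : HasCompactSupport ψ) (hpos : ∀ x, 0 ≤ ψ x)
    (heq : A * ∫ x : EuclideanSpace ℝ (Fin k), ψ x ^ p * ‖x‖ ^ (-γ)
      = ∫ x : EuclideanSpace ℝ (Fin k), |euclideanLaplacian ψ x| ^ p * ‖x‖ ^ (2 * p - γ)) :
    ∀ x, ψ x = 0 := by
  have : Nonempty (Fin k) := ⟨⟨0, hk⟩⟩
  have hp0 : 0 < p := by linarith
  set b : ℝ := γ - 2 + (p - 1) * ((k : ℝ) - 2) with hb
  have hb0 : 0 < b := by linarith
  have hκ0 : 0 < (k : ℝ) - γ := by linarith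
  set B : ℝ := ((k : ℝ) - γ) * b / p ^ 2 with hB
  have hB0 : 0 < B := by positivity
  have hAB : A = B ^ p := by
    rw [hA, hB, div_rpow (by positivity) (by positivity), mul_rpow hκ0.le hb0.le,
      ← rpow_natCast p 2, ← rpow_mul hp0.le]
    norm_num
  set c : ℝ := ((p - 1) * ((k : ℝ) - γ) + b) / p ^ 2 with hc
  have hcp : c * p ^ 2 = (p - 1) * ((k : ℝ) - γ) + b := by
    rw [hc]
    field_simp
  have hfin : Module.finrank ℝ (EuclideanSpace ℝ (Fin k)) = k := by simp
  let e : Fin k → EuclideanSpace ℝ (Fin k) := fun i => EuclideanSpace.single i 1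
  have he (i : Fin k) : ‖e i‖ = 1 := by simp [e]
  have hdiv (i : Fin k) := integral_rellichField_divergence (μ := volume) (γ := γ) hψ hsupp hpos hp
    (by rwa [hfin]) c (he i)
  -- integrability of the two sides of the Rellich inequality
  have hψint : Integrable fun x : EuclideanSpace ℝ (Fin k) => ψ x ^ p * ‖x‖ ^ (-γ) := by
    simpa only [abs_of_nonneg (hpos _)] using integrable_abs_rpow_mul_norm_rpow (μ := volume)
      hψ.continuous hsupp hp0 (s := -γ) (by rw [hfin]; linarith)
  have hΔint : Integrable fun x : EuclideanSpace ℝ (Fin k) =>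
      |euclideanLaplacian ψ x| ^ p * ‖x‖ ^ (2 * p - γ) :=
    integrable_abs_rpow_mul_norm_rpow (continuous_euclideanLaplacian hψ)
      (hasCompactSupport_euclideanLaplacian hψ hsupp) hp0 (by rw [hfin]; linarith)
  -- the nonnegative function with vanishing integral
  let D : Fin k → EuclideanSpace ℝ (Fin k) → ℝ := fun i => regularizedDivergence γ
    (fun x => ψ x ^ (p - 1) * fderiv ℝ (fun y => fderiv ℝ ψ y (e i)) x (e i) +
      (p - 1) * (ψ x ^ (p - 2) * fderiv ℝ ψ x (e i) ^ 2))
    (fun x => (2 - γ + c * p) * (ψ x ^ (p - 1) * fderiv ℝ ψ x (e i) * inner ℝ (e i) x))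
    (fun x => c * ψ x ^ p) (fun x => inner ℝ (e i) x ^ 2) 0
  let N : EuclideanSpace ℝ (Fin k) → ℝ := fun x =>
    |euclideanLaplacian ψ x| ^ p * ‖x‖ ^ (2 * p - γ) - A * (ψ x ^ p * ‖x‖ ^ (-γ)) +
      p * B ^ (p - 1) * ∑ i, D i x
  have hDint : Integrable fun x => ∑ i, D i x := integrable_finsetSum _ fun i _ => (hdiv i).1
  have hNint : Integrable N := (hΔint.sub (hψint.const_mul A)).add (hDint.const_mul _)
  have hN0 : ∫ x, N x = 0 := by
    have hsum : ∫ x, ∑ i, D i x = 0 := by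
      rw [integral_finsetSum _ fun i _ => (hdiv i).1]
      exact Finset.sum_eq_zero fun i _ => (hdiv i).2
    refine (integral_add (hΔint.sub (hψint.const_mul A)) (hDint.const_mul _)).trans ?_
    rw [integral_sub' hΔint (hψint.const_mul A), integral_const_mul, 
      integral_const_mul, hsum, heq]
    ring
  let X : EuclideanSpace ℝ (Fin k) → ℝ := fun x => ∑ i, fderiv ℝ ψ x (e i) * x i
  have hlower (x : EuclideanSpace ℝ (Fin k)) (hx : x ≠ 0) :
      ‖x‖ ^ (-γ) * (p * B ^ (p - 1) *
        ((p - 1) * (ψ x ^ (p - 2) * (X x + ((k : ℝ) - γ) / p * ψ x) ^ 2))) ≤ N x := by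
    have hr : 0 < ‖x‖ := norm_pos_iff.2 hx
    have hnorm : ∑ i, x i ^ 2 = ‖x‖ ^ 2 := (EuclideanSpace.real_norm_sq_eq x).symm
    have hg0 (h : ψ x = 0) (i : Fin k) : fderiv ℝ ψ x (e i) = 0 :=
      fderiv_apply_eq_zero_of_nonneg hpos h
    have hpt := rellich_pointwise (L := euclideanLaplacian ψ x) (X := X x)
      (G := ∑ i, fderiv ℝ ψ x (e i) ^ 2) (s := ‖x‖ ^ 2) hp hB0 hB hcp (hpos x) (by positivity)
      (by rw [← hnorm]; exact Finset.sum_mul_sq_le_sq_mul_sq _ _ _)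
      (fun h => by simp [X, hg0 h]) (fun h => by simp [hg0 h])
    refine (mul_le_mul_of_nonneg_left hpt (by positivity : 0 ≤ ‖x‖ ^ (-γ))).trans_eq ?_
    have hpow : |euclideanLaplacian ψ x| ^ p * ‖x‖ ^ (2 * p - γ) =
        ‖x‖ ^ (-γ) * (|euclideanLaplacian ψ x| * ‖x‖ ^ 2) ^ p := by
      rw [mul_rpow (abs_nonneg _) (by positivity), ← rpow_natCast ‖x‖ 2, ← rpow_mul hr.le,
        show 2 * p - γ = -γ + ((2 : ℕ) : ℝ) * p by push_cast; ring, rpow_add hr]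
      ring
    have hcoef : 2 - γ + c * p = 2 * (p - 1) * ((k : ℝ) - γ) / p := by
      rw [hc, hb]
      field_simp
      ring
    have hD : ∑ i, D i x = ‖x‖ ^ (-γ) * ((ψ x ^ (p - 1) * euclideanLaplacian ψ x +
        (p - 1) * (ψ x ^ (p - 2) * ∑ i, fderiv ℝ ψ x (e i) ^ 2)) * ‖x‖ ^ 2 +
        2 * (p - 1) * ((k : ℝ) - γ) / p * (ψ x ^ (p - 1) * X x) +
        c * ((k : ℝ) - γ) * ψ x ^ p) := by
      have hinner (i : Fin k) : inner ℝ (e i) x = x i := by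
        simp [e, EuclideanSpace.inner_single_left]
      have hrw : (‖x‖ ^ 2) ^ (-γ / 2) = ‖x‖ ^ (-γ) := by
        rw [← rpow_natCast, ← rpow_mul hr.le]
        congr 1
        push_cast
        ring
      have hlast : ∑ i : Fin k, (1 - γ * x i ^ 2 / ‖x‖ ^ 2) = (k : ℝ) - γ := by
        rw [Finset.sum_sub_distrib, ← Finset.sum_div, ← Finset.mul_sum, hnorm]
        field_simp
        simp
      simp only [D, regularizedDivergence, add_zero, hinner, hrw, hcoef]
      rw [← Finset.mul_sum, Finset.sum_add_distrib, Finset.sum_add_distrib, ← Finset.sum_mul,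
        Finset.sum_add_distrib, ← Finset.mul_sum, ← Finset.mul_sum, ← Finset.mul_sum,
        ← Finset.mul_sum, ← Finset.mul_sum, hlast, euclideanLaplacian_eq_sum_fderiv hψ]
      simp only [X, e, mul_assoc, ← Finset.mul_sum]
      ring
    simp only [N]
    rw [hD, hpow, hAB]
    ring
  have hne : ∀ᵐ x : EuclideanSpace ℝ (Fin k), x ≠ 0 := by simp [ae_iff]
  have hB1 : 0 < B ^ (p - 1) := rpow_pos_of_pos hB0 _
  have hp1 : 0 < p - 1 := by linarith
  have hNnonneg : 0 ≤ᵐ[volume] N := hne.mono fun x hx =>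
    le_trans (by have := rpow_nonneg (hpos x) (p - 2); positivity) (hlower x hx)
  have hNae := (integral_eq_zero_iff_of_nonneg_ae hNnonneg hNint).1 hN0
  have hXae : X =ᵐ[volume] fun x => -(((k : ℝ) - γ) / p * ψ x) := by
    filter_upwards [hNae, hne] with x hNx hx
    rcases (hpos x).eq_or_lt with h0 | h0
    · have hg0 (i : Fin k) : fderiv ℝ ψ x (e i) = 0 :=
        fderiv_apply_eq_zero_of_nonneg hpos h0.symm
      simp [X, hg0, ← h0]
    · have hle := hlower x hx
      have hr : 0 < ‖x‖ := norm_pos_iff.2 hx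
      rw [hNx] at hle
      by_contra hXne
      have : X x + ((k : ℝ) - γ) / p * ψ x ≠ 0 := fun h => hXne (by linarith)
      have hlt : 0 < ‖x‖ ^ (-γ) * (p * B ^ (p - 1) *
        ((p - 1) * (ψ x ^ (p - 2) * (X x + ((k : ℝ) - γ) / p * ψ x) ^ 2))) := by positivity
      exact hle.not_gt hlt
  have hXc : Continuous X := continuous_finsetSum _ fun i _ =>
    (hψ.fderiv_apply_const_one (e i)).continuous.mul (by fun_prop)
  have hXeq := (hXc.ae_eq_iff_eq volume
    (by have := hψ.continuous; fun_prop : Continuous fun x => -(((k : ℝ) - γ) / p * ψ x))).1 hXae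
  -- at a maximum point of `ψ` the gradient vanishes, hence so does `ψ`
  obtain ⟨x₀, hx₀⟩ := hψ.continuous.exists_forall_ge_of_hasCompactSupport hsupp
  have hmax : fderiv ℝ ψ x₀ = 0 := IsLocalMax.fderiv_eq_zero (Eventually.of_forall hx₀)
  have hψ₀ := congrFun hXeq x₀
  simp only [X, hmax, zero_apply, zero_mul, Finset.sum_const_zero] at hψ₀
  have : ψ x₀ = 0 := by
    have h : ((k : ℝ) - γ) / p * ψ x₀ = 0 := by linarith
    exact (mul_eq_zero.1 h).resolve_left (by positivity)
  exact fun x => le_antisymm (this ▸ hx₀ x) (hpos x)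
end
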